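/- arXiv:q-bio/0505023 — 2 statements merged into one kernel-verified Lean document; each statement's English description precedes it below -/
import Mathlib

section
/- Let G=(V,E) be a finite simple graph with V={1,...,v}, v ≥ 2 and e = |E| ≥ 1. Let (H1,H2) be a partition-encoding pair of haplotypes in {0,1}^{2v} and let S = {j ∈ V : H1 has a 1 in columns 2j−1 and 2j}. Then the sum, over all rows r of the block M_G of M(G), of min(d(r,H1), d(r,H2)) equals ev − 2·cut(S), where cut(S) is the number of edges of G with exactly one endpoint in S. -/
/-- A haplotype of length `m`: a string over `{0,1}`. -/
abbrev Haplo (m : ℕ) := Fin m → Bool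

/-- A row of an SNP matrix: entries in `{0,1,-}`, where `none` is a hole. -/
abbrev SnpRow (m : ℕ) := Fin m → Option Bool

/-- `dist r H` is the number of positions where `r` has a non-hole entry differing from `H`. -/
def dist {m : ℕ} (r : SnpRow m) (H : Haplo m) : ℕ :=
  (Finset.univ.filter fun p => r p ≠ none ∧ r p ≠ some (H p)).card

/-- An SNP matrix is feasible if two haplotypes fit all its rows. -/
def Feasible {ρ : Type} {m : ℕ} (M : ρ → SnpRow m) : Prop :=
  ∃ H1 H2 : Haplo m, ∀ i, dist (M i) H1 = 0 ∨ dist (M i) H2 = 0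

/-- Two matrices have the same hole pattern (flips never create or destroy holes). -/
def SamePattern {ρ : Type} {m : ℕ} (M M' : ρ → SnpRow m) : Prop :=
  ∀ i p, M i p = none ↔ M' i p = none

/-- Number of entries where the two matrices differ. -/
def flipCount {ρ : Type} [Fintype ρ] {m : ℕ} (M M' : ρ → SnpRow m) : ℕ :=
  (Finset.univ.filter fun q : ρ × Fin m => M q.1 q.2 ≠ M' q.1 q.2).card

/-- Minimum number of flips needed to make `M` feasible. -/
noncomputable def minFlips {ρ : Type} [Fintype ρ] {m : ℕ} (M : ρ → SnpRow m) : ℕ :=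
  sInf {c | ∃ M' : ρ → SnpRow m, SamePattern M M' ∧ Feasible M' ∧ flipCount M M' = c}

/-- The edges of `G`, as ordered pairs `(i,j)` with `i < j`. -/
def edgePairs (v : ℕ) (G : SimpleGraph (Fin v)) [DecidableRel G.Adj] :
    Finset (Fin v × Fin v) :=
  Finset.univ.filter fun p => p.1 < p.2 ∧ G.Adj p.1 p.2

/-- `e = |E|`. -/
def numEdges (v : ℕ) (G : SimpleGraph (Fin v)) [DecidableRel G.Adj] : ℕ :=
  (edgePairs v G).card

/-- A row of block `M_0` for vertex `j` (0-indexed): 0s in the two columns of `j`, holes elsewhere. -/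
def M0row (v : ℕ) (j : ℕ) : SnpRow (2 * v) :=
  fun c => if c.val / 2 = j then some false else none

/-- A row of block `M_1` for vertex `j` (0-indexed): 1s in the two columns of `j`, holes elsewhere. -/
def M1row (v : ℕ) (j : ℕ) : SnpRow (2 * v) :=
  fun c => if c.val / 2 = j then some true else none

/-- The row of block `M_G` for the edge `{i,j}` with `i < j` (0-indexed vertices):
0s in the columns of `i`, 1s in the columns of `j`, and `01` in the column pairs
of all other vertices. -/
def MGrow (v : ℕ) (i j : Fin v) : SnpRow (2 * v) :=
  fun c =>
    if c.val / 2 = i.val then some false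
    else if c.val / 2 = j.val then some true
    else some (decide (c.val % 2 = 1))

/-- Index type for the rows of block `M_G`: one row per edge. -/
abbrev EdgeIdx (v : ℕ) (G : SimpleGraph (Fin v)) [DecidableRel G.Adj] :=
  {p : Fin v × Fin v // p ∈ edgePairs v G}

/-- Index type for the rows of `M(G)`: `k = 2ev²` rows in each of `M_0` and `M_1`,
and one row per edge in `M_G`. -/
abbrev RowIdx (v : ℕ) (G : SimpleGraph (Fin v)) [DecidableRel G.Adj] :=
  Fin (2 * numEdges v G * v ^ 2) ⊕ (Fin (2 * numEdges v G * v ^ 2) ⊕ EdgeIdx v G)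

/-- The SNP matrix `M(G)`: each vertex `j` gets `k/v = 2ev` rows in `M_0` and in `M_1`
(row `t` of `M_0` belongs to vertex `t / (2ev)`), plus one `M_G` row per edge. -/
def MofG (v : ℕ) (G : SimpleGraph (Fin v)) [DecidableRel G.Adj] :
    RowIdx v G → SnpRow (2 * v)
  | .inl t => M0row v (t.val / (2 * numEdges v G * v))
  | .inr (.inl t) => M1row v (t.val / (2 * numEdges v G * v))
  | .inr (.inr p) => MGrow v p.val.1 p.val.2

/-- `cut(S)`: the number of edges of `G` with exactly one endpoint in `S`. -/
def cutS (v : ℕ) (G : SimpleGraph (Fin v)) [DecidableRel G.Adj] (S : Finset (Fin v)) : ℕ :=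
  ((edgePairs v G).filter fun p => (p.1 ∈ S ∧ p.2 ∉ S) ∨ (p.1 ∉ S ∧ p.2 ∈ S)).card

/-- `MAX-CUT(G)`. -/
def maxCut (v : ℕ) (G : SimpleGraph (Fin v)) [DecidableRel G.Adj] : ℕ :=
  Finset.univ.sup fun S : Finset (Fin v) => cutS v G S

/-- A haplotype on `2v` columns has the double-entry property if its entries on the
two columns of each vertex agree. -/
def DoubleEntry {v : ℕ} (H : Haplo (2 * v)) : Prop :=
  ∀ c c' : Fin (2 * v), c.val / 2 = c'.val / 2 → H c = H c'

/-- A pair of haplotypes is partition-encoding if both have the double-entry property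
and the second is the bitwise complement of the first. -/
def PartitionEncoding {v : ℕ} (H1 H2 : Haplo (2 * v)) : Prop :=
  DoubleEntry H1 ∧ DoubleEntry H2 ∧ ∀ c, H2 c = !H1 c

/-- The vertex set `S` encoded by a haplotype: vertices on whose columns `H1` has 1s. -/
def Sset {v : ℕ} (H1 : Haplo (2 * v)) : Finset (Fin v) :=
  Finset.univ.filter fun j => H1 ⟨2 * j.val, by have := j.isLt; omega⟩ = true

theorem aux_sum (f : ℕ → ℕ) (v : ℕ) :
    ∑ n ∈ Finset.range (2 * v), f n
      = ∑ k ∈ Finset.range v, (f (2 * k) + f (2 * k + 1)) := by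
  induction v with
  | zero => simp
  | succ n ih =>
    rw [show 2 * (n + 1) = 2 * n + 1 + 1 by ring, Finset.sum_range_succ, Finset.sum_range_succ,
      Finset.sum_range_succ, ih]
    ring

theorem aux_dist (v : ℕ) (H : Haplo (2 * v)) (hd : DoubleEntry H) (i j : Fin v) (hij : i < j) :
    dist (MGrow v i j) H + 2
      = v + (if i ∈ Sset H then 2 else 0) + (if j ∈ Sset H then 0 else 2) := by
  have h0 : dist (MGrow v i j) H = ∑ n ∈ Finset.range (2 * v),
      (if h : n < 2 * v then
        (if MGrow v i j ⟨n, h⟩ ≠ none ∧ MGrow v i j ⟨n, h⟩ ≠ some (H ⟨n, h⟩) then 1 else 0)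
        else 0) := by
    rw [Finset.sum_range]
    simp only [_root_.dist, Finset.card_filter, Fin.is_lt, dite_true, Fin.eta]
  rw [h0, aux_sum, Finset.sum_range]
  have key : ∀ k : Fin v,
      ((if h : 2 * k.val < 2 * v then
        (if MGrow v i j ⟨2 * k.val, h⟩ ≠ none ∧
          MGrow v i j ⟨2 * k.val, h⟩ ≠ some (H ⟨2 * k.val, h⟩) then 1 else 0) else 0)
      + (if h : 2 * k.val + 1 < 2 * v then
        (if MGrow v i j ⟨2 * k.val + 1, h⟩ ≠ none ∧
          MGrow v i j ⟨2 * k.val + 1, h⟩ ≠ some (H ⟨2 * k.val + 1, h⟩) then 1 else 0) else 0))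
      + ((if k = i then 1 else 0) + (if k = j then 1 else 0))
      = 1 + (if k = i then (if i ∈ Sset H then 2 else 0) else 0)
        + (if k = j then (if j ∈ Sset H then 0 else 2) else 0) := by
    intro k
    have hk := k.isLt
    have a : 2 * k.val < 2 * v := by omega
    have b : 2 * k.val + 1 < 2 * v := by omega
    have hH : H ⟨2 * k.val + 1, b⟩ = H ⟨2 * k.val, a⟩ := hd _ _ (by simp; omega)
    have e1 : 2 * k.val / 2 = k.val := by omega
    have e2 : (2 * k.val + 1) / 2 = k.val := by omega
    have e3 : 2 * k.val % 2 = 0 := by omega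
    have e4 : (2 * k.val + 1) % 2 = 1 := by omega
    have hS : k ∈ Sset H ↔ H ⟨2 * k.val, a⟩ = true := by simp [Sset]
    rw [dif_pos a, dif_pos b]
    simp only [MGrow, e1, e2, e3, e4, hH]
    by_cases hi : k = i
    · subst hi
      have : k ≠ j := ne_of_lt hij
      simp only [hS, this]
      cases H ⟨2 * k.val, a⟩ <;> simp
    · by_cases hj : k = j
      · subst hj
        have h' : k.val ≠ i.val := fun h => hi (Fin.ext h)
        simp only [hS, hi, h']
        cases H ⟨2 * k.val, a⟩ <;> simp
      · have h' : k.val ≠ i.val := fun h => hi (Fin.ext h)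
        have h'' : k.val ≠ j.val := fun h => hj (Fin.ext h)
        simp only [hi, h', hj, h'']
        cases H ⟨2 * k.val, a⟩ <;> simp
  have hs := Finset.sum_congr (rfl : (Finset.univ : Finset (Fin v)) = Finset.univ)
    (fun k _ => key k)
  rw [Finset.sum_add_distrib, Finset.sum_add_distrib (f := fun k => if k = i then 1 else 0),
    Finset.sum_add_distrib (g := fun k => if k = j then (if j ∈ Sset H then 0 else 2) else 0),
    Finset.sum_add_distrib (f := fun _ => 1)] at hs
  simp only [Finset.sum_ite_eq', Finset.mem_univ, if_true, Finset.sum_const, Finset.card_univ,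
    Fintype.card_fin, smul_eq_mul, mul_one] at hs
  exact hs

theorem stmt4 (v : ℕ) (hv : 2 ≤ v) (G : SimpleGraph (Fin v)) [DecidableRel G.Adj]
    (he : 1 ≤ numEdges v G) (H1 H2 : Haplo (2 * v))
    (hpe : PartitionEncoding H1 H2) :
    (∑ p ∈ edgePairs v G,
        min (dist (MGrow v p.1 p.2) H1) (dist (MGrow v p.1 p.2) H2))
      = numEdges v G * v - 2 * cutS v G (Sset H1) := by
  obtain ⟨h1, h2, hc⟩ := hpe
  have hS : ∀ k, k ∈ Sset H2 ↔ k ∉ Sset H1 := by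
    intro k
    simp [Sset, hc]
  have key : ∀ p ∈ edgePairs v G,
      min (dist (MGrow v p.1 p.2) H1) (dist (MGrow v p.1 p.2) H2)
        + 2 * (if (p.1 ∈ Sset H1 ∧ p.2 ∉ Sset H1) ∨ (p.1 ∉ Sset H1 ∧ p.2 ∈ Sset H1)
            then 1 else 0) = v := by
    intro p hp
    have hlt : p.1 < p.2 := by
      simp only [edgePairs, Finset.mem_filter] at hp
      exact hp.2.1
    have d1 := aux_dist v H1 h1 p.1 p.2 hlt
    have d2 := aux_dist v H2 h2 p.1 p.2 hlt
    simp only [hS] at d2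
    by_cases a : p.1 ∈ Sset H1 <;> by_cases b : p.2 ∈ Sset H1 <;> simp [a, b] at d1 d2 ⊢ <;> omega
  have hs := Finset.sum_congr rfl key
  rw [Finset.sum_add_distrib, ← Finset.mul_sum, ← Finset.card_filter, Finset.sum_const,
    smul_eq_mul] at hs
  unfold numEdges cutS
  omega
end

section
/- Let M be an n×m ungapped SNP matrix whose rows 1,...,n are ordered so that l(i) ≤ l(j) whenever i < j, augmented by two all-hole rows with indices 0 and −1. Then for all 1 ≤ i ≤ n and all k ∈ {−1,0,...,i−1} with r(i) ≤ r(k): D[i,k;i] = max over j ∈ OK(i) with j ≠ k and r(j) ≤ r(i) of ( D[j,k;i−1] + r(i) − max{r(j), l(i)−1} ). -/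
/-- Two rows conflict if some column has opposite non-hole entries in them. -/
def Conflict {m : ℕ} (r1 r2 : SnpRow m) : Prop :=
  ∃ (p : Fin m) (b1 b2 : Bool), r1 p = some b1 ∧ r2 p = some b2 ∧ b1 ≠ b2

/-- A row is ungapped if its non-hole entries occupy a contiguous interval of columns. -/
def Ungapped {m : ℕ} (r : SnpRow m) : Prop :=
  ∀ p q s : Fin m, p ≤ q → q ≤ s → r p ≠ none → r s ≠ none → r q ≠ none

/-- `l(r)`: leftmost non-hole column (1-indexed); `0` for an all-hole row. -/
noncomputable def lcol {m : ℕ} (r : SnpRow m) : ℕ :=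
  sInf {c | ∃ p : Fin m, r p ≠ none ∧ p.val + 1 = c}

/-- `r(r)`: rightmost non-hole column (1-indexed); `0` for an all-hole row. -/
def rcol {m : ℕ} (r : SnpRow m) : ℕ :=
  (Finset.univ.filter fun p : Fin m => r p ≠ none).sup fun p => p.val + 1

/-- The length of a haplotype: its number of non-hole columns. -/
def hlen {m : ℕ} (r : SnpRow m) : ℕ :=
  (Finset.univ.filter fun p : Fin m => r p ≠ none).card

/-- The merged haplotype of a set `R` of rows of `M`: at each column, the value some row
of `R` carries there, and a hole if all rows of `R` have a hole there. -/
def mergeRow {m : ℕ} (M : ℤ → SnpRow m) (R : Finset ℤ) : SnpRow m := fun p =>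
  if ∃ i ∈ R, M i p = some true then some true
  else if ∃ i ∈ R, M i p = some false then some false
  else none

/-- A set of rows is pairwise non-conflicting. -/
def PairwiseOK {m : ℕ} (M : ℤ → SnpRow m) (R : Finset ℤ) : Prop :=
  ∀ i ∈ R, ∀ j ∈ R, ¬ Conflict (M i) (M j)

open Classical in
/-- `LHR(M)`: the maximum of `length(merge A) + length(merge B)` over disjoint,
pairwise non-conflicting sets `A, B` of rows of `M` (rows `1,…,n`). -/
noncomputable def LHR {m : ℕ} (M : ℤ → SnpRow m) (n : ℕ) : ℕ :=
  (((Finset.Icc (1 : ℤ) n).powerset ×ˢ (Finset.Icc (1 : ℤ) n).powerset).filter fun q =>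
      Disjoint q.1 q.2 ∧ PairwiseOK M q.1 ∧ PairwiseOK M q.2).sup fun q =>
    hlen (mergeRow M q.1) + hlen (mergeRow M q.2)

open Classical in
/-- `D[h,k;i]`: the maximum of `length(merge A) + length(merge B)` over disjoint,
pairwise non-conflicting sets `A, B` of rows from `{-1,0,1,…,i}` such that `k ∈ A`
maximizes `r(⬝)` in `A` and `h ∈ B` maximizes `r(⬝)` in `B`. -/
noncomputable def Dval {m : ℕ} (M : ℤ → SnpRow m) (h k i : ℤ) : ℕ :=
  (((Finset.Icc (-1 : ℤ) i).powerset ×ˢ (Finset.Icc (-1 : ℤ) i).powerset).filter fun q =>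
      Disjoint q.1 q.2 ∧ PairwiseOK M q.1 ∧ PairwiseOK M q.2 ∧
      k ∈ q.1 ∧ (∀ a ∈ q.1, rcol (M a) ≤ rcol (M k)) ∧
      h ∈ q.2 ∧ (∀ b ∈ q.2, rcol (M b) ≤ rcol (M h))).sup fun q =>
    hlen (mergeRow M q.1) + hlen (mergeRow M q.2)

open Classical in
/-- `OK(i)`: the rows `j ∈ {-1,0,…,i-1}` that do not conflict with row `i`. -/
noncomputable def OKset {m : ℕ} (M : ℤ → SnpRow m) (i : ℤ) : Finset ℤ :=
  (Finset.Icc (-1 : ℤ) (i - 1)).filter fun j => ¬ Conflict (M j) (M i)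

theorem aux_le_rcol {m : ℕ} (r : SnpRow m) (p : Fin m) (h : r p ≠ none) : p.val + 1 ≤ rcol r :=
  Finset.le_sup (f := fun p : Fin m => p.val + 1) (by simpa using h)

theorem aux_lcol_le {m : ℕ} (r : SnpRow m) (p : Fin m) (h : r p ≠ none) : lcol r ≤ p.val + 1 :=
  Nat.sInf_le ⟨p, h, rfl⟩

theorem aux_rcol_le {m : ℕ} (r : SnpRow m) : rcol r ≤ m :=
  Finset.sup_le fun p _ => p.2

theorem aux_cover {m : ℕ} (r : SnpRow m) (hr : Ungapped r) (p : Fin m) :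
    r p ≠ none ↔ lcol r ≤ p.val + 1 ∧ p.val + 1 ≤ rcol r := by
  refine ⟨fun h => ⟨aux_lcol_le r p h, aux_le_rcol r p h⟩, ?_⟩
  rintro ⟨h1, h2⟩
  have hex : ∃ s : Fin m, r s ≠ none ∧ p.val + 1 ≤ s.val + 1 := by
    by_contra! hc
    have : rcol r ≤ p.val := by
      refine Finset.sup_le fun s hs => ?_
      have := hc s (by simpa using hs)
      omega
    omega
  obtain ⟨s, hs, hps⟩ := hex
  have hne : {c | ∃ p : Fin m, r p ≠ none ∧ p.val + 1 = c}.Nonempty := ⟨_, s, hs, rfl⟩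
  obtain ⟨q, hq, hq2⟩ := Nat.sInf_mem hne
  have hq3 : q.val + 1 = lcol r := hq2
  exact hr q p s (by rw [Fin.le_def]; omega) (by rw [Fin.le_def]; omega) hq hs

theorem aux_merge {m : ℕ} (M : ℤ → SnpRow m) (R : Finset ℤ) (p : Fin m) :
    mergeRow M R p ≠ none ↔ ∃ i ∈ R, M i p ≠ none := by
  unfold mergeRow
  constructor
  · intro h
    split_ifs at h with h1 h2
    · obtain ⟨i, hi, h⟩ := h1
      exact ⟨i, hi, by simp [h]⟩
    · obtain ⟨i, hi, h⟩ := h2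
      exact ⟨i, hi, by simp [h]⟩
    · exact absurd rfl h
  · rintro ⟨i, hi, h⟩
    split_ifs with h1 h2
    · simp
    · simp
    · exfalso
      rcases hb : M i p with _ | b
      · exact h hb
      · cases b
        · exact h2 ⟨i, hi, hb⟩
        · exact h1 ⟨i, hi, hb⟩

theorem aux_card {m : ℕ} (a b : ℕ) (hb : b ≤ m) :
    (Finset.univ.filter fun p : Fin m => a < p.val + 1 ∧ p.val + 1 ≤ b).card = b - a := by
  rw [← Nat.card_Ico, ← Finset.card_map Fin.valEmbedding]
  congr 1
  ext x
  simp only [Finset.mem_map, Finset.mem_filter, Finset.mem_univ, true_and, Finset.mem_Ico,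
    Fin.valEmbedding_apply]
  constructor
  · rintro ⟨p, hp, rfl⟩
    omega
  · intro hx
    exact ⟨⟨x, by omega⟩, by simp only; omega, rfl⟩

theorem aux_hlen {m : ℕ} (M : ℤ → SnpRow m) (R : Finset ℤ) (i j : ℤ) (hi : Ungapped (M i))
    (hjR : j ∈ R) (hj : Ungapped (M j)) (hl : lcol (M j) ≤ lcol (M i))
    (hmax : ∀ b ∈ R, rcol (M b) ≤ rcol (M j)) :
    hlen (mergeRow M (insert i R)) =
      hlen (mergeRow M R) + (rcol (M i) - max (rcol (M j)) (lcol (M i) - 1)) := by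
  rw [← aux_card (m := m) _ _ (aux_rcol_le (M i))]
  unfold hlen
  rw [← Finset.card_union_of_disjoint]
  · congr 1
    ext p
    simp only [Finset.mem_filter, Finset.mem_univ, true_and, Finset.mem_union, aux_merge,
      Finset.exists_mem_insert]
    constructor
    · rintro (h | h)
      · rw [aux_cover _ hi] at h
        by_cases hp : p.val + 1 ≤ rcol (M j)
        · exact Or.inl ⟨j, hjR, (aux_cover _ hj p).2 ⟨by omega, hp⟩⟩
        · right
          omega
      · exact Or.inl h
    · rintro (h | h)
      · exact Or.inr h
      · left
        rw [aux_cover _ hi]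
        omega
  · rw [Finset.disjoint_left]
    intro p hp hp2
    simp only [Finset.mem_filter, Finset.mem_univ, true_and, aux_merge] at hp hp2
    obtain ⟨b, hb, hbp⟩ := hp
    have h1 := aux_le_rcol _ _ hbp
    have h2 := hmax b hb
    omega

theorem aux_conf_symm {m : ℕ} {r s : SnpRow m} (h : Conflict r s) : Conflict s r := by
  obtain ⟨p, a, b, h1, h2, h3⟩ := h
  exact ⟨p, b, a, h2, h1, h3.symm⟩

theorem aux_conf_self {m : ℕ} (r : SnpRow m) : ¬ Conflict r r := by
  rintro ⟨p, a, b, h1, h2, h3⟩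
  rw [h1] at h2
  exact h3 (Option.some.inj h2)

theorem aux_conf {m : ℕ} {ri rj rb : SnpRow m} (hj : Ungapped rj) (hl : lcol rj ≤ lcol ri)
    (hr : rcol rb ≤ rcol rj) (hji : ¬ Conflict rj ri) (hbj : ¬ Conflict rb rj) :
    ¬ Conflict rb ri := by
  rintro ⟨p, a, b, h1, h2, h3⟩
  have hb := aux_le_rcol rb p (by simp [h1])
  have hi := aux_lcol_le ri p (by simp [h2])
  have hjp := (aux_cover rj hj p).2 ⟨by omega, by omega⟩
  obtain ⟨c, hc⟩ := Option.ne_none_iff_exists'.1 hjp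
  by_cases hca : a = c
  · exact hji ⟨p, c, b, hc, h2, by rw [← hca]; exact h3⟩
  · exact hbj ⟨p, a, c, h1, hc, hca⟩

theorem aux_le_Dval {m : ℕ} (M : ℤ → SnpRow m) (h k i : ℤ) (A B : Finset ℤ)
    (hA : A ⊆ Finset.Icc (-1 : ℤ) i) (hB : B ⊆ Finset.Icc (-1 : ℤ) i) (hd : Disjoint A B)
    (pA : PairwiseOK M A) (pB : PairwiseOK M B)
    (hk : k ∈ A) (mk : ∀ a ∈ A, rcol (M a) ≤ rcol (M k))
    (hh : h ∈ B) (mh : ∀ b ∈ B, rcol (M b) ≤ rcol (M h)) :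
    hlen (mergeRow M A) + hlen (mergeRow M B) ≤ Dval M h k i := by
  unfold Dval
  refine Finset.le_sup (f := fun q : Finset ℤ × Finset ℤ =>
    hlen (mergeRow M q.1) + hlen (mergeRow M q.2)) (b := (A, B)) ?_
  simp only [Finset.mem_filter, Finset.mem_product, Finset.mem_powerset]
  exact ⟨⟨hA, hB⟩, hd, pA, pB, hk, mk, hh, mh⟩

theorem aux_Dval_le {m : ℕ} (M : ℤ → SnpRow m) (h k i : ℤ) (x : ℕ)
    (H : ∀ A B : Finset ℤ, A ⊆ Finset.Icc (-1 : ℤ) i → B ⊆ Finset.Icc (-1 : ℤ) i →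
      Disjoint A B → PairwiseOK M A → PairwiseOK M B →
      k ∈ A → (∀ a ∈ A, rcol (M a) ≤ rcol (M k)) →
      h ∈ B → (∀ b ∈ B, rcol (M b) ≤ rcol (M h)) →
      hlen (mergeRow M A) + hlen (mergeRow M B) ≤ x) : Dval M h k i ≤ x := by
  unfold Dval
  refine Finset.sup_le ?_
  rintro ⟨A, B⟩ hq
  simp only [Finset.mem_filter, Finset.mem_product, Finset.mem_powerset] at hq
  obtain ⟨⟨hA, hB⟩, hd, pA, pB, hk, mk, hh, mh⟩ := hq
  exact H A B hA hB hd pA pB hk mk hh mh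

theorem aux_Dval_att {m : ℕ} (M : ℤ → SnpRow m) (h k i : ℤ) (hne : h ≠ k)
    (hi : h ∈ Finset.Icc (-1 : ℤ) i) (ki : k ∈ Finset.Icc (-1 : ℤ) i) :
    ∃ A B : Finset ℤ, A ⊆ Finset.Icc (-1 : ℤ) i ∧ B ⊆ Finset.Icc (-1 : ℤ) i ∧
      Disjoint A B ∧ PairwiseOK M A ∧ PairwiseOK M B ∧
      k ∈ A ∧ (∀ a ∈ A, rcol (M a) ≤ rcol (M k)) ∧
      h ∈ B ∧ (∀ b ∈ B, rcol (M b) ≤ rcol (M h)) ∧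
      Dval M h k i = hlen (mergeRow M A) + hlen (mergeRow M B) := by
  classical
  have hs : ∀ x : ℤ, PairwiseOK M {x} := by
    intro x a ha b hb
    rw [Finset.mem_singleton] at ha hb
    subst ha hb
    exact aux_conf_self _
  by_contra! hc
  have h1 : ∀ x, Dval M h k i ≤ x ∨ x < Dval M h k i := fun x => le_or_gt _ _
  have hlt : Dval M h k i ≤ Dval M h k i - 1 := by
    refine aux_Dval_le M h k i _ ?_
    intro A B a1 a2 a3 a4 a5 a6 a7 a8 a9
    have e1 := hc A B a1 a2 a3 a4 a5 a6 a7 a8 a9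
    have e2 := aux_le_Dval M h k i A B a1 a2 a3 a4 a5 a6 a7 a8 a9
    omega
  have b1 : ({k} : Finset ℤ) ⊆ Finset.Icc (-1 : ℤ) i := by simpa using ki
  have b2 : ({h} : Finset ℤ) ⊆ Finset.Icc (-1 : ℤ) i := by simpa using hi
  have b3 : Disjoint ({k} : Finset ℤ) {h} := by simpa using hne.symm
  have e1 := hc {k} {h} b1 b2 b3 (hs k) (hs h) (by simp) (by simp) (by simp) (by simp)
  have e2 := aux_le_Dval M h k i {k} {h} b1 b2 b3 (hs k) (hs h) (by simp) (by simp) (by simp)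
    (by simp)
  omega

theorem stmt8 (n m : ℕ) (M : ℤ → SnpRow m)
    (hug : ∀ i : ℤ, 1 ≤ i → i ≤ n → Ungapped (M i))
    (h0 : M 0 = fun _ => none) (hm1 : M (-1) = fun _ => none)
    (hord : ∀ i j : ℤ, 1 ≤ i → i < j → j ≤ n → lcol (M i) ≤ lcol (M j)) :
    ∀ i : ℤ, 1 ≤ i → i ≤ n →
      ∀ k ∈ Finset.Icc (-1 : ℤ) (i - 1), rcol (M i) ≤ rcol (M k) →
        Dval M i k i =
          ((OKset M i).filter fun j => j ≠ k ∧ rcol (M j) ≤ rcol (M i)).sup fun j =>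
            Dval M j k (i - 1) + (rcol (M i) - max (rcol (M j)) (lcol (M i) - 1)) := by
  classical
  intro i hi1 hin k hk hik
  have hk' := Finset.mem_Icc.1 hk
  have hole : ∀ j : ℤ, -1 ≤ j → j < 1 → M j = fun _ => none := by
    intro j h1 h2
    have : j = 0 ∨ j = -1 := by omega
    rcases this with rfl | rfl
    · exact h0
    · exact hm1
  have hU : ∀ j : ℤ, -1 ≤ j → j ≤ i → Ungapped (M j) := by
    intro j h1 h2
    by_cases hj : 1 ≤ j
    · exact hug j hj (by omega)
    · rw [hole j h1 (by omega)]
      intro p q s _ _ h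
      exact absurd rfl h
  have hrz : ∀ j : ℤ, -1 ≤ j → j < 1 → rcol (M j) = 0 := by
    intro j h1 h2
    rw [hole j h1 h2]
    simp [rcol]
  have hL : ∀ j : ℤ, -1 ≤ j → j < i → lcol (M j) ≤ lcol (M i) := by
    intro j h1 h2
    by_cases hj : 1 ≤ j
    · exact hord j i hj h2 hin
    · rw [hole j h1 (by omega)]
      simp [lcol]
  have hUi := hU i (by omega) le_rfl
  apply le_antisymm
  · refine aux_Dval_le M i k i _ ?_
    intro A B hA hB hd pA pB hkA mk hiB mi
    have hiA : i ∉ A := fun h => Finset.disjoint_left.1 hd h hiB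
    -- it suffices to find a suitable pair
    have key : ∀ (A' B' : Finset ℤ) (j : ℤ), A' ⊆ A → k ∈ A' → j ∈ B' →
        j ≠ k → -1 ≤ j → j < i → B' ⊆ Finset.Icc (-1 : ℤ) (i - 1) → Disjoint A' B' →
        PairwiseOK M B' → ¬ Conflict (M j) (M i) → (∀ b ∈ B', rcol (M b) ≤ rcol (M j)) →
        rcol (M j) ≤ rcol (M i) →
        hlen (mergeRow M A') = hlen (mergeRow M A) →
        hlen (mergeRow M B) = hlen (mergeRow M (insert i B')) →
        hlen (mergeRow M A) + hlen (mergeRow M B) ≤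
          ((OKset M i).filter fun j => j ≠ k ∧ rcol (M j) ≤ rcol (M i)).sup fun j =>
            Dval M j k (i - 1) + (rcol (M i) - max (rcol (M j)) (lcol (M i) - 1)) := by
      intro A' B' j hA' hkA' hjB' hjk hj1 hj2 hB' hd' pB' hc hmax hr eA eB
      refine le_trans ?_ (Finset.le_sup (b := j) ?_)
      · rw [eB, aux_hlen M B' i j hUi hjB' (hU j hj1 hj2.le) (hL j hj1 hj2) hmax, ← eA]
        have := aux_le_Dval M j k (i - 1) A' B' ?_ hB' hd' ?_ pB' hkA' ?_ hjB' hmax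
        · omega
        · intro a ha
          have h1 := Finset.mem_Icc.1 (hA (hA' ha))
          have h2 : a ≠ i := fun h => hiA (h ▸ hA' ha)
          rw [Finset.mem_Icc]
          omega
        · exact fun a ha b hb => pA a (hA' ha) b (hA' hb)
        · exact fun a ha => mk a (hA' ha)
      · simp only [Finset.mem_filter, OKset, Finset.mem_Icc]
        exact ⟨⟨⟨hj1, by omega⟩, hc⟩, hjk, hr⟩
    by_cases hne : (B.erase i).Nonempty
    · obtain ⟨j, hj, hjm⟩ := Finset.exists_max_image _ (fun b => rcol (M b)) hne
      have hjB := Finset.mem_of_mem_erase hj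
      have hji := Finset.ne_of_mem_erase hj
      have hjI := Finset.mem_Icc.1 (hB hjB)
      refine key A (B.erase i) j (Finset.Subset.refl _) hkA hj ?_ hjI.1 (by omega) ?_ ?_ ?_
        (pB j hjB i hiB) hjm (mi j hjB) rfl ?_
      · rintro rfl
        exact Finset.disjoint_left.1 hd hkA hjB
      · intro b hb
        have h1 := Finset.mem_Icc.1 (hB (Finset.mem_of_mem_erase hb))
        have h2 := Finset.ne_of_mem_erase hb
        rw [Finset.mem_Icc]
        omega
      · exact Finset.disjoint_of_subset_right (Finset.erase_subset _ _) hd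
      · exact fun a ha b hb => pB a (Finset.mem_of_mem_erase ha) b (Finset.mem_of_mem_erase hb)
      · rw [Finset.insert_erase hiB]
    · have hBe : B = {i} := by
        rw [Finset.not_nonempty_iff_eq_empty] at hne
        rw [← Finset.insert_erase hiB, hne]; rfl
      obtain ⟨j, hj1, hj2, hjk⟩ : ∃ j : ℤ, -1 ≤ j ∧ j < 1 ∧ j ≠ k := by
        by_cases h : k = 0
        · exact ⟨-1, by omega, by omega, by omega⟩
        · exact ⟨0, by omega, by omega, by omega⟩
      have hjn := hole j hj1 hj2
      have hjr := hrz j hj1 hj2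
      refine key (A.erase j) {j} j (Finset.erase_subset _ _)
        (Finset.mem_erase.2 ⟨hjk.symm, hkA⟩) (by simp) hjk hj1 (by omega) ?_ (by simp) ?_ ?_
        (by simp) (by omega) ?_ ?_
      · intro b hb
        rw [Finset.mem_singleton] at hb
        rw [Finset.mem_Icc]
        omega
      · intro a ha b hb
        rw [Finset.mem_singleton] at ha hb
        subst ha hb
        exact aux_conf_self _
      · rintro ⟨p, a, b, h1, -⟩
        rw [hjn] at h1
        simp at h1
      · unfold hlen
        congr 1
        ext p
        simp only [Finset.mem_filter, Finset.mem_univ, true_and, aux_merge]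
        constructor
        · rintro ⟨a, ha, h⟩
          exact ⟨a, Finset.mem_of_mem_erase ha, h⟩
        · rintro ⟨a, ha, h⟩
          refine ⟨a, Finset.mem_erase.2 ⟨?_, ha⟩, h⟩
          rintro rfl
          rw [hjn] at h
          exact h rfl
      · rw [hBe]
        unfold hlen
        congr 1
        ext p
        simp only [Finset.mem_filter, Finset.mem_univ, true_and, aux_merge,
          Finset.exists_mem_insert, Finset.mem_singleton, exists_eq_left]
        simp [hjn]
  · refine Finset.sup_le ?_
    intro j hj
    simp only [Finset.mem_filter, OKset] at hj
    obtain ⟨⟨hjI, hc⟩, hjk, hr⟩ := hj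
    obtain ⟨A, B, hA, hB, hd, pA, pB, hkA, mk, hjB, mj, hD⟩ :=
      aux_Dval_att M j k (i - 1) hjk hjI hk
    have hjI' := Finset.mem_Icc.1 hjI
    have hUj := hU j hjI'.1 (by omega)
    have hLj := hL j hjI'.1 (by omega)
    rw [hD, add_assoc, ← aux_hlen M B i j hUi hjB hUj hLj mj]
    have hsub : Finset.Icc (-1 : ℤ) (i - 1) ⊆ Finset.Icc (-1 : ℤ) i :=
      Finset.Icc_subset_Icc le_rfl (by omega)
    have hbi : ∀ b ∈ B, ¬ Conflict (M b) (M i) := fun b hb =>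
      aux_conf hUj hLj (mj b hb) hc (pB b hb j hjB)
    refine aux_le_Dval M i k i A (insert i B) (hA.trans hsub) ?_ ?_ pA ?_ hkA mk
      (Finset.mem_insert_self _ _) ?_
    · refine Finset.insert_subset ?_ (hB.trans hsub)
      rw [Finset.mem_Icc]
      omega
    · rw [Finset.disjoint_insert_right]
      refine ⟨fun h => ?_, hd⟩
      have := Finset.mem_Icc.1 (hA h)
      omega
    · intro a ha b hb
      rw [Finset.mem_insert] at ha hb
      rcases ha with rfl | ha <;> rcases hb with rfl | hb
      · exact aux_conf_self _
      · exact fun h => hbi b hb (aux_conf_symm h)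
      · exact hbi a ha
      · exact pB a ha b hb
    · intro b hb
      rw [Finset.mem_insert] at hb
      rcases hb with rfl | hb
      · exact le_rfl
      · exact (mj b hb).trans hr
end
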